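/- Let E be a finite-dimensional real inner product space and F : E → ℝ∪{+∞} a closed convex function, three times continuously differentiable on its open convex effective domain dom F, with positive definite Hessian ∇²F(x) at every x ∈ dom F, and self-concordant with M = 2: |D³F(x)[u,u,u]| ≤ 2 (⟨∇²F(x)u,u⟩)^{3/2} for all x ∈ dom F, u ∈ E. Define the Newton decrement λ(x) = ⟨(∇²F(x))^{−1}∇F(x), ∇F(x)⟩^{1/2} and ω(t) = t − ln(1 + t). Then for every x ∈ dom F with ∇F(x) ≠ 0, the damped Newton iterate x⁺ = x − (1 + λ(x))^{−1}(∇²F(x))^{−1}∇F(x) belongs to dom F and satisfies F(x⁺) ≤ F(x) − ω(λ(x)). -/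

import Mathlib

open scoped Classical RealInnerProductSpace

/-- The Hessian quadratic form `⟨∇²F(x)u, u⟩` of `F` at `x` in direction `u`. -/
noncomputable def hessQ {E : Type*} [NormedAddCommGroup E] [NormedSpace ℝ E]
    (F : E → ℝ) (x u : E) : ℝ :=
  iteratedFDeriv ℝ 2 F x ![u, u]

/-- The Hessian bilinear form `⟨∇²F(x)u, v⟩`. -/
noncomputable def hessB {E : Type*} [NormedAddCommGroup E] [NormedSpace ℝ E]
    (F : E → ℝ) (x u v : E) : ℝ :=
  iteratedFDeriv ℝ 2 F x ![u, v]

/-- The third directional derivative `D³F(x)[u,u,u]`. -/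
noncomputable def thirdD {E : Type*} [NormedAddCommGroup E] [NormedSpace ℝ E]
    (F : E → ℝ) (x u : E) : ℝ :=
  iteratedFDeriv ℝ 3 F x ![u, u, u]

/-- If `f` has nonnegative derivative on `[0, r]`, then `f 0 ≤ f r`. -/
lemma le_of_hasDerivAt_nonneg {f f' : ℝ → ℝ} {r : ℝ} (hr : 0 ≤ r)
    (hf : ∀ t ∈ Set.Icc 0 r, HasDerivAt f (f' t) t) (hf' : ∀ t ∈ Set.Icc 0 r, 0 ≤ f' t) :
    f 0 ≤ f r := by
  refine monotoneOn_of_deriv_nonneg (convex_Icc 0 r)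
    (fun t ht => (hf t ht).continuousAt.continuousWithinAt)
    (fun t ht => (hf t (interior_subset ht)).differentiableAt.differentiableWithinAt)
    (fun t ht => ?_) (Set.left_mem_Icc.2 hr) (Set.right_mem_Icc.2 hr) hr
  rw [(hf t (interior_subset ht)).deriv]
  exact hf' t (interior_subset ht)

/-- The second derivative of a one-dimensional self-concordant function grows at most like
`a² / (1 - a t)²`, where `a²` is its value at `0`. -/
lemma selfConcordant_second_deriv_le {q q' : ℝ → ℝ} {a r : ℝ} (ha : 0 < a) (hr : 0 ≤ r)
    (har : a * r < 1) (hq : ∀ t ∈ Set.Icc 0 r, HasDerivAt q (q' t) t)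
    (hpos : ∀ t ∈ Set.Icc 0 r, 0 < q t)
    (hsc : ∀ t ∈ Set.Icc 0 r, |q' t| ≤ 2 * (q t) ^ ((3 : ℝ) / 2)) (h0 : q 0 = a ^ 2) :
    q r ≤ a ^ 2 / (1 - a * r) ^ 2 := by
  have key := le_of_hasDerivAt_nonneg (f := fun t => (√(q t))⁻¹ + t)
    (f' := fun t => -(q' t / (2 * √(q t))) / √(q t) ^ 2 + 1) hr
    (fun t ht => (((hq t ht).sqrt (hpos t ht).ne').fun_inv
      (Real.sqrt_pos.2 (hpos t ht)).ne').add (hasDerivAt_id t)) (fun t ht => by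
      have hs := Real.sqrt_pos.2 (hpos t ht)
      have hpow : (q t) ^ ((3 : ℝ) / 2) = √(q t) ^ 3 := by
        rw [Real.sqrt_eq_rpow, ← Real.rpow_natCast, ← Real.rpow_mul (hpos t ht).le]
        norm_num
      have h := (abs_le.1 (hsc t ht)).2
      rw [hpow] at h
      have : q' t / (2 * √(q t)) / √(q t) ^ 2 ≤ 1 := by
        rw [div_div, div_le_one (by positivity)]
        nlinarith
      rw [neg_div]
      linarith)
  have hs := Real.sqrt_pos.2 (hpos r (Set.right_mem_Icc.2 hr))
  simp only [h0, Real.sqrt_sq ha.le, add_zero] at key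
  have hd : 0 < 1 - a * r := by linarith
  have hle : √(q r) ≤ a / (1 - a * r) := by
    rw [le_div_iff₀ hd]
    have h1 : a⁻¹ * (a * √(q r)) ≤ ((√(q r))⁻¹ + r) * (a * √(q r)) := by gcongr
    have h2 : a⁻¹ * (a * √(q r)) = √(q r) := by field_simp
    have h3 : ((√(q r))⁻¹ + r) * (a * √(q r)) = a + a * r * √(q r) := by field_simp
    linarith
  calc q r = √(q r) ^ 2 := (Real.sq_sqrt (hpos r (Set.right_mem_Icc.2 hr)).le).symm
    _ ≤ (a / (1 - a * r)) ^ 2 := by gcongr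
    _ = a ^ 2 / (1 - a * r) ^ 2 := div_pow _ _ _

/-- Upper bound for a one-dimensional self-concordant function started at Newton scaling:
`φ'(0) = -a²` and `φ''(0) = a²`. -/
lemma selfConcordant_le {φ φ' q q' : ℝ → ℝ} {a r : ℝ} (ha : 0 < a) (hr : 0 ≤ r)
    (har : a * r < 1) (hφ : ∀ t ∈ Set.Icc 0 r, HasDerivAt φ (φ' t) t)
    (hφ' : ∀ t ∈ Set.Icc 0 r, HasDerivAt φ' (q t) t)
    (hq : ∀ t ∈ Set.Icc 0 r, HasDerivAt q (q' t) t)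
    (hpos : ∀ t ∈ Set.Icc 0 r, 0 < q t)
    (hsc : ∀ t ∈ Set.Icc 0 r, |q' t| ≤ 2 * (q t) ^ ((3 : ℝ) / 2))
    (h0' : φ' 0 = -a ^ 2) (h0 : q 0 = a ^ 2) :
    φ r ≤ φ 0 - a ^ 2 * r - a * r - Real.log (1 - a * r) := by
  have hd : ∀ t ∈ Set.Icc 0 r, 0 < 1 - a * t := fun t ht => by nlinarith [ht.2]
  have hsub : ∀ t ∈ Set.Icc 0 r, Set.Icc 0 t ⊆ Set.Icc 0 r :=
    fun t ht => Set.Icc_subset_Icc_right ht.2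
  have hlin : ∀ t : ℝ, HasDerivAt (fun t => 1 - a * t) (-a) t := fun t => by
    simpa using ((hasDerivAt_id t).const_mul a).const_sub 1
  have hq_le : ∀ t ∈ Set.Icc 0 r, q t ≤ a ^ 2 / (1 - a * t) ^ 2 := fun t ht =>
    selfConcordant_second_deriv_le ha ht.1 (by linarith [hd t ht])
      (fun s hs => hq s (hsub t ht hs)) (fun s hs => hpos s (hsub t ht hs))
      (fun s hs => hsc s (hsub t ht hs)) h0
  have hφ'_le : ∀ t ∈ Set.Icc 0 r, φ' t ≤ -a ^ 2 + a * ((1 - a * t)⁻¹ - 1) := fun t ht => by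
    have := le_of_hasDerivAt_nonneg (f := fun s => a * (1 - a * s)⁻¹ - φ' s)
      (f' := fun s => a * (-(-a) / (1 - a * s) ^ 2) - q s) ht.1
      (fun s hs => (((hlin s).fun_inv (hd s (hsub t ht hs)).ne').const_mul a).sub
        (hφ' s (hsub t ht hs)))
      (fun s hs => by
        have := hq_le s (hsub t ht hs)
        rw [neg_neg, mul_div_assoc', ← pow_two]
        linarith)
    simp only [mul_zero, sub_zero, inv_one, mul_one, h0'] at this
    linarith
  have := le_of_hasDerivAt_nonneg
    (f := fun s => -a ^ 2 * s - a * s - Real.log (1 - a * s) - φ s)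
    (f' := fun s => -a ^ 2 * 1 - a * 1 - (-a) / (1 - a * s) - φ' s) hr
    (fun s hs => (((((hasDerivAt_id s).const_mul _).sub ((hasDerivAt_id s).const_mul _)).sub
      ((hlin s).log (hd s hs).ne')).sub (hφ s hs)))
    (fun s hs => by
      have := hφ'_le s hs
      rw [neg_div, div_eq_mul_inv]
      linarith)
  simp only [mul_zero, sub_zero, Real.log_one] at this
  linarith

section Line

variable {E : Type*} [NormedAddCommGroup E] [NormedSpace ℝ E] {F : E → ℝ} (x p : E) {t : ℝ}

lemma hasDerivAt_sub_smul (t : ℝ) : HasDerivAt (fun s : ℝ => x - s • p) (-p) t := by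
  simpa using ((hasDerivAt_id t).smul_const p).const_sub x

lemma hasDerivAt_along_line (hF : ContDiffAt ℝ 3 F (x - t • p)) :
    HasDerivAt (fun s : ℝ => F (x - s • p)) (-fderiv ℝ F (x - t • p) p) t := by
  rw [← map_neg]
  exact (hF.differentiableAt (by norm_num)).hasFDerivAt.comp_hasDerivAt t
    (hasDerivAt_sub_smul x p t)

lemma hasDerivAt_fderiv_along_line (hF : ContDiffAt ℝ 3 F (x - t • p)) :
    HasDerivAt (fun s : ℝ => -fderiv ℝ F (x - s • p) p) (hessQ F (x - t • p) p) t := by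
  have hd : DifferentiableAt ℝ (fderiv ℝ F) (x - t • p) :=
    (hF.fderiv_right (m := 2) (by norm_num)).differentiableAt (by norm_num)
  have e : hessQ F (x - t • p) p
      = -(ContinuousLinearMap.apply ℝ ℝ p (fderiv ℝ (fderiv ℝ F) (x - t • p) (-p))) := by
    rw [map_neg, map_neg, neg_neg, hessQ, iteratedFDeriv_two_apply]
    rfl
  rw [e]
  exact ((ContinuousLinearMap.apply ℝ ℝ p).hasFDerivAt.comp_hasDerivAt t
    (hd.hasFDerivAt.comp_hasDerivAt t (hasDerivAt_sub_smul x p t))).neg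

lemma hasDerivAt_hessQ_along_line (hF : ContDiffAt ℝ 3 F (x - t • p)) :
    HasDerivAt (fun s : ℝ => hessQ F (x - s • p) p) (-thirdD F (x - t • p) p) t := by
  have hd : DifferentiableAt ℝ (iteratedFDeriv ℝ 2 F) (x - t • p) :=
    hF.differentiableAt_iteratedFDeriv (by norm_num)
  have e : -thirdD F (x - t • p) p = ContinuousMultilinearMap.apply ℝ (fun _ : Fin 2 => E) ℝ
      ![p, p] (fderiv ℝ (iteratedFDeriv ℝ 2 F) (x - t • p) (-p)) := by
    rw [map_neg, map_neg, thirdD, iteratedFDeriv_succ_apply_left]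
    rfl
  rw [e]
  exact (ContinuousMultilinearMap.apply ℝ (fun _ : Fin 2 => E) ℝ
    ![p, p]).hasFDerivAt.comp_hasDerivAt t
    (hd.hasFDerivAt.comp_hasDerivAt t (hasDerivAt_sub_smul x p t))

end Line

/-- **Damped Newton step decreases a self-concordant function by `ω(λ(x))`.**
Let `λ(x) = ⟨(∇²F(x))⁻¹∇F(x), ∇F(x)⟩^{1/2}` (here `p` is the Newton direction,
`∇²F(x)p = ∇F(x)`, so `λ(x) = ⟨∇F(x), p⟩^{1/2}`) and `ω(t) = t − ln(1+t)`.  If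
`∇F(x) ≠ 0`, then the damped Newton iterate `x⁺ = x − (1+λ(x))⁻¹ p` lies in
`dom F` and `F(x⁺) ≤ F(x) − ω(λ(x))`. -/
theorem sc_damped_newton_step {E : Type*} [NormedAddCommGroup E]
    [InnerProductSpace ℝ E] [FiniteDimensional ℝ E]
    (D : Set E) (hDo : IsOpen D) (hDc : Convex ℝ D)
    (F : E → ℝ)
    (hclosed : LowerSemicontinuous (fun x => if x ∈ D then (F x : EReal) else ⊤))
    (hconv : ConvexOn ℝ D F)
    (hF : ContDiffOn ℝ 3 F D)
    (hpos : ∀ x ∈ D, ∀ u : E, u ≠ 0 → 0 < hessQ F x u)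
    (hsc : ∀ x ∈ D, ∀ u : E, |thirdD F x u| ≤ 2 * (hessQ F x u) ^ ((3 : ℝ) / 2))
    (x : E) (hx : x ∈ D) (hgrad : gradient F x ≠ 0) (p : E)
    (hp : ∀ v : E, hessB F x p v = ⟪gradient F x, v⟫)
    (lam : ℝ) (hlamdef : lam = Real.sqrt ⟪gradient F x, p⟫) :
    x - (1 + lam)⁻¹ • p ∈ D ∧
    F (x - (1 + lam)⁻¹ • p) ≤ F x - (lam - Real.log (1 + lam)) := by
  have hFat : ∀ y ∈ D, ContDiffAt ℝ 3 F y := fun y hy => hF.contDiffAt (hDo.mem_nhds hy)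
  have hgr : ∀ v, ⟪gradient F x, v⟫ = fderiv ℝ F x v := fun v => by
    simp [gradient, InnerProductSpace.toDual_symm_apply]
  have hp0 : p ≠ 0 := by
    rintro rfl
    refine hgrad (ext_inner_right ℝ fun v => ?_)
    rw [← hp v, hessB, iteratedFDeriv_two_apply]
    simp
  have hQ : hessQ F x p = ⟪gradient F x, p⟫ := hp p
  have hgp : 0 < ⟪gradient F x, p⟫ := hQ ▸ hpos x hx p hp0
  have hlam : 0 < lam := hlamdef ▸ Real.sqrt_pos.2 hgp
  have hlam2 : lam ^ 2 = ⟪gradient F x, p⟫ := by rw [hlamdef, Real.sq_sqrt hgp.le]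
  have hT : ∀ r ≤ (1 + lam)⁻¹, lam * r < 1 := fun r hr => by
    have h : lam * r ≤ lam * (1 + lam)⁻¹ := by gcongr
    have h' : lam * (1 + lam)⁻¹ < 1 := by
      rw [← div_eq_mul_inv, div_lt_one (by positivity)]
      linarith
    exact h.trans_lt h'
  have bound : ∀ r, 0 ≤ r → r ≤ (1 + lam)⁻¹ → (∀ t ∈ Set.Icc 0 r, x - t • p ∈ D) →
      F (x - r • p) ≤ F x - lam ^ 2 * r - lam * r - Real.log (1 - lam * r) := by
    intro r hr hrT hD
    have := selfConcordant_le hlam hr (hT r hrT)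
      (fun t ht => hasDerivAt_along_line x p (hFat _ (hD t ht)))
      (fun t ht => hasDerivAt_fderiv_along_line x p (hFat _ (hD t ht)))
      (fun t ht => hasDerivAt_hessQ_along_line x p (hFat _ (hD t ht)))
      (fun t ht => hpos _ (hD t ht) p hp0)
      (fun t ht => by rw [abs_neg]; exact hsc _ (hD t ht) p)
      (by rw [zero_smul, sub_zero, hlam2, hgr]) (by rw [zero_smul, sub_zero, hlam2, hQ])
    simpa using this
  have hline : Continuous fun t : ℝ => x - t • p := by fun_prop
  have hmem : ∀ t ∈ Set.Icc 0 (1 + lam)⁻¹, x - t • p ∈ D := by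
    by_contra! hne
    obtain ⟨s, ⟨hsI, hsD⟩, hmin⟩ :=
      (isCompact_Icc.inter_right (hDo.isClosed_compl.preimage hline)).exists_isLeast hne
    have hlt : ∀ t ∈ Set.Ico 0 s, x - t • p ∈ D := fun t ht => by
      by_contra h
      exact absurd (hmin ⟨⟨ht.1, ht.2.le.trans hsI.2⟩, h⟩) (not_le.2 ht.2)
    have hs0 : 0 < s := hsI.1.lt_of_ne (by rintro rfl; exact hsD (by simpa using hx))
    have hcont : ContinuousOn
        (fun t => F x - lam ^ 2 * t - lam * t - Real.log (1 - lam * t)) (Set.Icc 0 s) := by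
      have hne0 : ∀ t ∈ Set.Icc 0 s, 1 - lam * t ≠ 0 := fun t ht =>
        sub_ne_zero.2 (hT t (ht.2.trans hsI.2)).ne'
      fun_prop (disch := assumption)
    obtain ⟨C, hC⟩ := isCompact_Icc.bddAbove_image hcont
    have hclosedC := (hclosed.isClosed_preimage (C : EReal)).preimage hline
    have hsub : Set.Ico 0 s ⊆ (fun t : ℝ => x - t • p) ⁻¹'
        ((fun x => if x ∈ D then (F x : EReal) else ⊤) ⁻¹' Set.Iic (C : EReal)) := fun t ht => by
      have h := (bound t ht.1 (ht.2.le.trans hsI.2)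
        fun u hu => hlt u ⟨hu.1, hu.2.trans_lt ht.2⟩).trans
        (hC (Set.mem_image_of_mem _ (Set.Ico_subset_Icc_self ht)))
      simp only [Set.mem_preimage, if_pos (hlt t ht), Set.mem_Iic]
      exact_mod_cast h
    have hmem_s := closure_minimal hsub hclosedC
      (closure_Ico hs0.ne ▸ Set.right_mem_Icc.2 hs0.le)
    simp only [Set.mem_preimage, if_neg (show x - s • p ∉ D from hsD), Set.mem_Iic, top_le_iff]
      at hmem_s
    exact EReal.coe_ne_top C hmem_s
  have hT0 : 0 ≤ (1 + lam)⁻¹ := by positivity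
  refine ⟨hmem _ (Set.right_mem_Icc.2 hT0), (bound _ hT0 le_rfl hmem).trans_eq ?_⟩
  have h1 : 1 - lam * (1 + lam)⁻¹ = (1 + lam)⁻¹ := by field_simp; ring
  rw [h1, Real.log_inv]
  field_simp
  ring
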